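/- arXiv:2405.10360 — 2 statements merged into one kernel-verified Lean document; each statement's English description precedes it below -/
import Mathlib

section
/- Let d ≥ 2, let μ be the Haar probability measure on the compact group U(d) of d×d complex unitary matrices, fix a unit vector ψ₀ ∈ ℂ^d, let A ∈ M_d(ℂ) be Hermitian with tr(A) = 0 and A² = 1, and let W ∈ M_d(ℂ) be unitary. For V ∈ U(d) define f(V) := ⟨Vψ₀, A Vψ₀⟩ − ⟨Vψ₀, W* A W Vψ₀⟩ (a real number). Then for every δ > 0, μ{V ∈ U(d) : |f(V)| ≥ δ} ≤ (2/((d+1)·δ²)) · (1 − Re(tr(A W* A W))/d). -/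
open Matrix MeasureTheory

section HaarMoments

variable {n : Type*} [Fintype n]

lemma star_dotProduct_self_eq_sum_normSq (v : n → ℂ) :
    star v ⬝ᵥ v = ((∑ i, Complex.normSq (v i) : ℝ) : ℂ) := by
  simp [dotProduct, Complex.normSq_eq_conj_mul_self]

variable [DecidableEq n]

lemma exists_unitary_col_eq (u : n → ℂ) (hu : star u ⬝ᵥ u = 1) (k : n) :
    ∃ Q : Matrix.unitaryGroup n ℂ, ∀ i, (Q : Matrix n n ℂ) i k = u i := by
  have hnorm : ‖WithLp.toLp 2 u‖ = 1 := by
    have h : inner ℂ (WithLp.toLp 2 u) (WithLp.toLp 2 u) = (1 : ℂ) := by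
      rw [EuclideanSpace.inner_toLp_toLp, dotProduct_comm, hu]
    rw [inner_self_eq_norm_sq_to_K] at h
    have h' : ‖WithLp.toLp 2 u‖ ^ 2 = 1 := by
      apply Complex.ofReal_injective
      simpa using h
    nlinarith [norm_nonneg (WithLp.toLp 2 u)]
  have horth : Orthonormal ℂ
      (({k} : Set n).domRestrict fun _ => (WithLp.toLp 2 u : EuclideanSpace ℂ n)) :=
    ⟨fun _ => hnorm, fun i j hij => (hij (Subsingleton.elim i j)).elim⟩
  obtain ⟨b, hb⟩ := horth.exists_orthonormalBasis_extension_of_card_eq (by simp)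
  refine ⟨⟨_, (EuclideanSpace.basisFun n ℂ).toMatrix_orthonormalBasis_mem_unitary b⟩, fun i => ?_⟩
  simp [Module.Basis.toMatrix_apply, hb k rfl]

lemma star_mulVec_dotProduct_mulVec_unitary (Q : Matrix.unitaryGroup n ℂ) (v : n → ℂ) :
    star ((Q : Matrix n n ℂ) *ᵥ v) ⬝ᵥ ((Q : Matrix n n ℂ) *ᵥ v) = star v ⬝ᵥ v := by
  rw [star_mulVec, ← dotProduct_mulVec, mulVec_mulVec, ← star_eq_conjTranspose,
    Unitary.coe_star_mul_self, one_mulVec]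

lemma sum_normSq_unitary_mulVec {ψ : n → ℂ} (hψ : star ψ ⬝ᵥ ψ = 1)
    (V : Matrix.unitaryGroup n ℂ) :
    ∑ i, Complex.normSq (((V : Matrix n n ℂ) *ᵥ ψ) i) = 1 := by
  have h := star_mulVec_dotProduct_mulVec_unitary V ψ
  rw [star_dotProduct_self_eq_sum_normSq, hψ] at h
  exact_mod_cast h

lemma trace_sq_eq_sum_eigenvalues_sq {B : Matrix n n ℂ} (hB : B.IsHermitian) :
    ((∑ i, hB.eigenvalues i ^ 2 : ℝ) : ℂ) = (B * B).trace := by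
  conv_rhs => rw [hB.spectral_theorem]
  rw [← map_mul, Unitary.conjStarAlgAut_apply, trace_mul_comm, ← mul_assoc,
    Unitary.coe_star_mul_self, one_mul, diagonal_mul_diagonal, trace_diagonal]
  simp [sq]

lemma star_dotProduct_mulVec_eq_sum_eigenvalues {B : Matrix n n ℂ} (hB : B.IsHermitian)
    (φ : n → ℂ) :
    (star φ ⬝ᵥ (B *ᵥ φ)).re = ∑ i, hB.eigenvalues i *
      Complex.normSq ((((star hB.eigenvectorUnitary : Matrix.unitaryGroup n ℂ) :
        Matrix n n ℂ) *ᵥ φ) i) := by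
  conv_lhs => rw [hB.spectral_theorem]
  rw [Unitary.conjStarAlgAut_apply, ← mulVec_mulVec, ← mulVec_mulVec, dotProduct_mulVec]
  have hstar : star φ ᵥ* (hB.eigenvectorUnitary : Matrix n n ℂ) =
      star (star (hB.eigenvectorUnitary : Matrix n n ℂ) *ᵥ φ) := by
    rw [star_mulVec, ← star_eq_conjTranspose, star_star]
  rw [hstar, dotProduct, Complex.re_sum]
  refine Finset.sum_congr rfl fun i _ => ?_
  rw [mulVec_diagonal, Unitary.coe_star, Complex.normSq_apply]
  simp only [Pi.star_apply, RCLike.star_def, Function.comp_apply, Complex.coe_algebraMap,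
    Complex.mul_re, Complex.mul_im, Complex.conj_re, Complex.conj_im,
    Complex.ofReal_re, Complex.ofReal_im]
  ring

variable [MeasurableSpace (Matrix.unitaryGroup n ℂ)] [BorelSpace (Matrix.unitaryGroup n ℂ)]
  (μ : Measure (Matrix.unitaryGroup n ℂ))

lemma integrable_comp_unitary_mulVec [IsFiniteMeasure μ] {ψ : n → ℂ} (hψ : star ψ ⬝ᵥ ψ = 1) {g : (n → ℂ) → ℝ}
    (hg : Continuous g) :
    Integrable (fun V : Matrix.unitaryGroup n ℂ => g ((V : Matrix n n ℂ) *ᵥ ψ)) μ := by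
  obtain ⟨C, hC⟩ := (isCompact_closedBall (0 : n → ℂ) 1).exists_bound_of_continuousOn
    hg.continuousOn
  refine Integrable.of_bound (C := C) (hg.comp
    (continuous_subtype_val.matrix_mulVec continuous_const)).aestronglyMeasurable
    (.of_forall fun V => hC _ ?_)
  rw [mem_closedBall_zero_iff, pi_norm_le_iff_of_nonneg zero_le_one]
  intro k
  rw [← sq_le_one_iff₀ (norm_nonneg _), ← Complex.normSq_eq_norm_sq,
    ← sum_normSq_unitary_mulVec hψ V]
  exact Finset.single_le_sum
    (f := fun k => Complex.normSq (((V : Matrix n n ℂ) *ᵥ ψ) k))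
    (fun _ _ => Complex.normSq_nonneg _) (Finset.mem_univ k)

variable [μ.IsMulLeftInvariant]

lemma integral_comp_unitary_mulVec (ψ : n → ℂ) (Q : Matrix.unitaryGroup n ℂ)
    (g : (n → ℂ) → ℝ) :
    ∫ V : Matrix.unitaryGroup n ℂ, g ((Q : Matrix n n ℂ) *ᵥ ((V : Matrix n n ℂ) *ᵥ ψ)) ∂μ =
      ∫ V : Matrix.unitaryGroup n ℂ, g ((V : Matrix n n ℂ) *ᵥ ψ) ∂μ := by
  rw [← integral_mul_left_eq_self
    (fun V : Matrix.unitaryGroup n ℂ => g ((V : Matrix n n ℂ) *ᵥ ψ)) Q]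
  simp [mulVec_mulVec]

lemma integral_normSq_dotProduct_sq (ψ : n → ℂ) (u : n → ℂ) (hu : star u ⬝ᵥ u = 1) (k : n) :
    ∫ V : Matrix.unitaryGroup n ℂ,
        Complex.normSq (star u ⬝ᵥ ((V : Matrix n n ℂ) *ᵥ ψ)) ^ 2 ∂μ =
      ∫ V : Matrix.unitaryGroup n ℂ, Complex.normSq (((V : Matrix n n ℂ) *ᵥ ψ) k) ^ 2 ∂μ := by
  obtain ⟨Q, hQ⟩ := exists_unitary_col_eq u hu k
  rw [← integral_comp_unitary_mulVec μ ψ (star Q) fun φ => Complex.normSq (φ k) ^ 2]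
  have h : ∀ φ : n → ℂ, ((star Q : Matrix.unitaryGroup n ℂ) : Matrix n n ℂ).mulVec φ k =
      star u ⬝ᵥ φ := fun φ => by
    simp [mulVec, dotProduct, star_apply, hQ]
  simp only [h]

lemma normSq_polarization (a b : ℂ) :
    16 * (Complex.normSq a * Complex.normSq b) =
      (Complex.normSq (a + b) ^ 2 + Complex.normSq (a - b) ^ 2 +
        Complex.normSq (a + Complex.I * b) ^ 2 + Complex.normSq (a - Complex.I * b) ^ 2)
      - 4 * Complex.normSq a ^ 2 - 4 * Complex.normSq b ^ 2 := by
  simp [Complex.normSq_apply]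
  ring

lemma integral_normSq_add_mul_sq (ψ : n → ℂ) {i j : n} (hij : i ≠ j) (c : ℂ)
    (hc : Complex.normSq c = 1) (k : n) :
    ∫ V : Matrix.unitaryGroup n ℂ, Complex.normSq
        (((V : Matrix n n ℂ) *ᵥ ψ) i + c * ((V : Matrix n n ℂ) *ᵥ ψ) j) ^ 2 ∂μ =
      4 * ∫ V : Matrix.unitaryGroup n ℂ, Complex.normSq (((V : Matrix n n ℂ) *ᵥ ψ) k) ^ 2 ∂μ := by
  have hs : (((√2 : ℝ) : ℂ))⁻¹ * (((√2 : ℝ) : ℂ))⁻¹ = 1 / 2 := by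
    rw [← mul_inv, ← Complex.ofReal_mul, Real.mul_self_sqrt zero_le_two]
    norm_num
  have hcc : c * (starRingEnd ℂ) c = 1 := by rw [Complex.mul_conj, hc, Complex.ofReal_one]
  set u : n → ℂ := (((√2 : ℝ) : ℂ))⁻¹ • (Pi.single i 1 + Pi.single j (star c)) with hudef
  have hstar : ∀ φ : n → ℂ, star u ⬝ᵥ φ = (((√2 : ℝ) : ℂ))⁻¹ * (φ i + c * φ j) := fun φ => by
    simp [hudef, star_smul, star_add, Pi.star_single, add_dotProduct, smul_dotProduct, mul_add]
  have hu : star u ⬝ᵥ u = 1 := by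
    rw [hstar]
    simp only [hudef, Pi.smul_apply, Pi.add_apply, Pi.single_eq_same, smul_eq_mul,
      Pi.single_eq_of_ne hij, Pi.single_eq_of_ne hij.symm, RCLike.star_def]
    linear_combination (1 + c * (starRingEnd ℂ) c) * hs + 1 / 2 * hcc
  rw [← integral_normSq_dotProduct_sq μ ψ u hu k, ← integral_const_mul]
  refine integral_congr_ae (.of_forall fun V => ?_)
  simp only [hstar, Complex.normSq_mul, Complex.normSq_inv, Complex.normSq_ofReal,
    Real.mul_self_sqrt zero_le_two]
  ring

lemma integral_normSq_mul_normSq_of_ne [IsFiniteMeasure μ] {ψ : n → ℂ} (hψ : star ψ ⬝ᵥ ψ = 1) {i j : n}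
    (hij : i ≠ j) (k : n) :
    ∫ V : Matrix.unitaryGroup n ℂ, Complex.normSq (((V : Matrix n n ℂ) *ᵥ ψ) i) *
        Complex.normSq (((V : Matrix n n ℂ) *ᵥ ψ) j) ∂μ =
      (∫ V : Matrix.unitaryGroup n ℂ,
        Complex.normSq (((V : Matrix n n ℂ) *ᵥ ψ) k) ^ 2 ∂μ) / 2 := by
  have hint : ∀ c : ℂ, Integrable (fun V : Matrix.unitaryGroup n ℂ => Complex.normSq
      (((V : Matrix n n ℂ) *ᵥ ψ) i + c * ((V : Matrix n n ℂ) *ᵥ ψ) j) ^ 2) μ := fun c =>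
    integrable_comp_unitary_mulVec μ hψ (g := fun φ => Complex.normSq (φ i + c * φ j) ^ 2)
      ((Complex.continuous_normSq.comp (by fun_prop)).pow 2)
  have hint' : ∀ l : n, Integrable (fun V : Matrix.unitaryGroup n ℂ =>
      4 * Complex.normSq (((V : Matrix n n ℂ) *ᵥ ψ) l) ^ 2) μ := fun l =>
    (integrable_comp_unitary_mulVec μ hψ (g := fun φ => Complex.normSq (φ l) ^ 2)
      ((Complex.continuous_normSq.comp (continuous_apply l)).pow 2)).const_mul 4
  have hcoord : ∀ l : n, ∫ V : Matrix.unitaryGroup n ℂ,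
      Complex.normSq (((V : Matrix n n ℂ) *ᵥ ψ) l) ^ 2 ∂μ =
      ∫ V : Matrix.unitaryGroup n ℂ, Complex.normSq (((V : Matrix n n ℂ) *ᵥ ψ) k) ^ 2 ∂μ :=
    fun l => by
      simpa [Pi.star_single] using
        integral_normSq_dotProduct_sq μ ψ (Pi.single l 1) (by simp [Pi.star_single]) k
  have hpol : ∀ V : Matrix.unitaryGroup n ℂ,
      Complex.normSq (((V : Matrix n n ℂ) *ᵥ ψ) i) *
        Complex.normSq (((V : Matrix n n ℂ) *ᵥ ψ) j) = 1 / 16 * (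
      Complex.normSq (((V : Matrix n n ℂ) *ᵥ ψ) i + 1 * ((V : Matrix n n ℂ) *ᵥ ψ) j) ^ 2 +
      Complex.normSq (((V : Matrix n n ℂ) *ᵥ ψ) i + -1 * ((V : Matrix n n ℂ) *ᵥ ψ) j) ^ 2 +
      Complex.normSq (((V : Matrix n n ℂ) *ᵥ ψ) i +
        Complex.I * ((V : Matrix n n ℂ) *ᵥ ψ) j) ^ 2 +
      Complex.normSq (((V : Matrix n n ℂ) *ᵥ ψ) i +
        -Complex.I * ((V : Matrix n n ℂ) *ᵥ ψ) j) ^ 2 -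
      4 * Complex.normSq (((V : Matrix n n ℂ) *ᵥ ψ) i) ^ 2 -
      4 * Complex.normSq (((V : Matrix n n ℂ) *ᵥ ψ) j) ^ 2) := fun V => by
    have h := normSq_polarization (((V : Matrix n n ℂ) *ᵥ ψ) i) (((V : Matrix n n ℂ) *ᵥ ψ) j)
    simp only [one_mul, neg_mul, ← sub_eq_add_neg]
    linarith
  simp only [hpol]
  rw [integral_const_mul, integral_sub _ (hint' j), integral_sub _ (hint' i),
    integral_add _ (hint _), integral_add _ (hint _), integral_add (hint _) (hint _),
    integral_const_mul, integral_const_mul, hcoord i, hcoord j,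
    integral_normSq_add_mul_sq μ ψ hij 1 (by simp) k,
    integral_normSq_add_mul_sq μ ψ hij (-1) (by simp) k,
    integral_normSq_add_mul_sq μ ψ hij Complex.I (by simp) k,
    integral_normSq_add_mul_sq μ ψ hij (-Complex.I) (by simp) k]
  · ring
  · exact (hint _).add (hint _)
  · exact ((hint _).add (hint _)).add (hint _)
  · exact (((hint _).add (hint _)).add (hint _)).add (hint _)
  · exact ((((hint _).add (hint _)).add (hint _)).add (hint _)).sub (hint' i)

variable [IsProbabilityMeasure μ]

lemma integral_normSq_mul_normSq {ψ : n → ℂ} (hψ : star ψ ⬝ᵥ ψ = 1) (i j : n) :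
    ∫ V : Matrix.unitaryGroup n ℂ, Complex.normSq (((V : Matrix n n ℂ) *ᵥ ψ) i) *
        Complex.normSq (((V : Matrix n n ℂ) *ᵥ ψ) j) ∂μ =
      (1 + if i = j then 1 else 0) / (Fintype.card n * (Fintype.card n + 1)) := by
  set m := ∫ V : Matrix.unitaryGroup n ℂ, Complex.normSq (((V : Matrix n n ℂ) *ᵥ ψ) i) ^ 2 ∂μ
    with hm
  have hmom : ∀ k l : n, ∫ V : Matrix.unitaryGroup n ℂ,
      Complex.normSq (((V : Matrix n n ℂ) *ᵥ ψ) k) *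
        Complex.normSq (((V : Matrix n n ℂ) *ᵥ ψ) l) ∂μ =
      m / 2 * (1 + if k = l then 1 else 0) := fun k l => by
    split_ifs with hkl
    · subst hkl
      have h := integral_normSq_dotProduct_sq μ ψ (Pi.single k 1) (by simp [Pi.star_single]) i
      simp only [Pi.star_single, star_one, single_one_dotProduct] at h
      simp only [← sq, h, ← hm]
      ring
    · rw [integral_normSq_mul_normSq_of_ne μ hψ hkl i, ← hm]
      ring
  have hsum : ∑ k : n, ∑ l : n, m / 2 * (1 + if k = l then 1 else 0) = 1 := by
    simp only [← hmom]
    have hint : ∀ k l : n, Integrable (fun V : Matrix.unitaryGroup n ℂ =>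
        Complex.normSq (((V : Matrix n n ℂ) *ᵥ ψ) k) *
          Complex.normSq (((V : Matrix n n ℂ) *ᵥ ψ) l)) μ := fun k l =>
      integrable_comp_unitary_mulVec μ hψ
        (g := fun φ => Complex.normSq (φ k) * Complex.normSq (φ l))
        ((Complex.continuous_normSq.comp (continuous_apply k)).mul
          (Complex.continuous_normSq.comp (continuous_apply l)))
    simp_rw [← integral_finsetSum _ fun l _ => hint _ l]
    rw [← integral_finsetSum _ fun k _ => integrable_finsetSum _ fun l _ => hint k l]
    simp [← Finset.mul_sum, sum_normSq_unitary_mulVec hψ]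
  simp only [← Finset.mul_sum, Finset.sum_add_distrib, Finset.sum_ite_eq, Finset.mem_univ,
    if_true, Finset.sum_const, Finset.card_univ, nsmul_eq_mul, mul_one] at hsum
  have hcard : (0 : ℝ) < Fintype.card n := by
    exact_mod_cast Fintype.card_pos_iff.mpr ⟨i⟩
  rw [hmom, eq_div_iff (by positivity)]
  linear_combination (1 + if i = j then (1 : ℝ) else 0) * hsum

/-- Second moment of a diagonal quadratic form in a Haar-random state. -/
lemma integral_sq_sum_mul_normSq {ψ : n → ℂ} (hψ : star ψ ⬝ᵥ ψ = 1) (c : n → ℝ) :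
    ∫ V : Matrix.unitaryGroup n ℂ,
        (∑ i, c i * Complex.normSq (((V : Matrix n n ℂ) *ᵥ ψ) i)) ^ 2 ∂μ =
      ((∑ i, c i) ^ 2 + ∑ i, c i ^ 2) / (Fintype.card n * (Fintype.card n + 1)) := by
  have hint : ∀ k l : n, Integrable (fun V : Matrix.unitaryGroup n ℂ => c k * c l *
      (Complex.normSq (((V : Matrix n n ℂ) *ᵥ ψ) k) *
        Complex.normSq (((V : Matrix n n ℂ) *ᵥ ψ) l))) μ := fun k l =>
    integrable_comp_unitary_mulVec μ hψ
      (g := fun φ => c k * c l * (Complex.normSq (φ k) * Complex.normSq (φ l)))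
      (((Complex.continuous_normSq.comp (continuous_apply k)).mul
        (Complex.continuous_normSq.comp (continuous_apply l))).const_mul _)
  simp only [sq, Finset.sum_mul_sum, mul_mul_mul_comm (c _)]
  rw [integral_finsetSum _ fun k _ => integrable_finsetSum _ fun l _ => hint k l]
  simp_rw [integral_finsetSum _ fun l _ => hint _ l, integral_const_mul,
    integral_normSq_mul_normSq μ hψ, ← mul_div_assoc, ← Finset.sum_div, mul_add, mul_one,
    mul_ite, mul_one, mul_zero, Finset.sum_add_distrib, Finset.sum_ite_eq, Finset.mem_univ,
    if_true]

/-- Second moment of the expectation value of a Hermitian matrix in a Haar-random state. -/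
lemma integral_sq_re_star_dotProduct_mulVec {ψ : n → ℂ} (hψ : star ψ ⬝ᵥ ψ = 1)
    {B : Matrix n n ℂ} (hB : B.IsHermitian) :
    ∫ V : Matrix.unitaryGroup n ℂ,
        (star ((V : Matrix n n ℂ) *ᵥ ψ) ⬝ᵥ (B *ᵥ ((V : Matrix n n ℂ) *ᵥ ψ))).re ^ 2 ∂μ =
      (B.trace.re ^ 2 + (B * B).trace.re) / (Fintype.card n * (Fintype.card n + 1)) := by
  simp only [star_dotProduct_mulVec_eq_sum_eigenvalues hB]
  rw [integral_comp_unitary_mulVec μ ψ (star hB.eigenvectorUnitary)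
    fun φ => (∑ i, hB.eigenvalues i * Complex.normSq (φ i)) ^ 2,
    integral_sq_sum_mul_normSq μ hψ, ← trace_sq_eq_sum_eigenvalues_sq hB,
    hB.trace_eq_sum_eigenvalues]
  simp [← Complex.ofReal_sum]

end HaarMoments

/-- For a Haar-random input state `Vψ₀`, the probability that an
attack unitary `W` changes the prediction of the classifier with (traceless,
Hermitian, unitary) Heisenberg-evolved measurement operator `A` by at least `δ` is
bounded by `2 (1 - Re tr(A W* A W)/d) / ((d+1) δ²)`, an OTOC bound. -/
theorem stmt5 {d : ℕ} (hd : 2 ≤ d)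
    [MeasurableSpace (Matrix.unitaryGroup (Fin d) ℂ)]
    [BorelSpace (Matrix.unitaryGroup (Fin d) ℂ)]
    (μ : Measure (Matrix.unitaryGroup (Fin d) ℂ))
    [μ.IsHaarMeasure] [IsProbabilityMeasure μ]
    (ψ₀ : Fin d → ℂ) (hψ₀ : star ψ₀ ⬝ᵥ ψ₀ = 1)
    (A : Matrix (Fin d) (Fin d) ℂ)
    (hA : A.IsHermitian) (hAtr : A.trace = 0) (hA2 : A * A = 1)
    (W : Matrix (Fin d) (Fin d) ℂ) (hW : W ∈ Matrix.unitaryGroup (Fin d) ℂ)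
    (δ : ℝ) (hδ : 0 < δ) :
    μ {V : Matrix.unitaryGroup (Fin d) ℂ |
        δ ≤ |(star ((V : Matrix (Fin d) (Fin d) ℂ).mulVec ψ₀) ⬝ᵥ
                A.mulVec ((V : Matrix (Fin d) (Fin d) ℂ).mulVec ψ₀)).re
            - (star ((V : Matrix (Fin d) (Fin d) ℂ).mulVec ψ₀) ⬝ᵥ
                (star W * A * W).mulVec ((V : Matrix (Fin d) (Fin d) ℂ).mulVec ψ₀)).re|}
      ≤ ENNReal.ofReal
          ((2 / ((d + 1) * δ ^ 2)) * (1 - (Matrix.trace (A * star W * A * W)).re / d)) := by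
  have hd0 : (0 : ℝ) < d := by exact_mod_cast (by omega : 0 < d)
  have hsq : star W * W = 1 := Unitary.star_mul_self_of_mem hW
  have hsq' : W * star W = 1 := Unitary.mul_star_self_of_mem hW
  set B := A - star W * A * W with hBdef
  have hB : B.IsHermitian := by
    have hWA : (star W * A * W).IsHermitian := isHermitian_conjTranspose_mul_mul W hA
    exact hA.sub hWA
  have hBtr : B.trace = 0 := by
    rw [hBdef, trace_sub, trace_mul_comm, ← mul_assoc, hsq', one_mul, sub_self]
  have hB2 : (B * B).trace.re = 2 * (d - (trace (A * star W * A * W)).re) := by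
    have hexp : B * B = 1 - A * star W * A * W - star W * A * W * A + 1 := by
      have h1 : star W * A * W * (star W * A * W) = 1 := by
        rw [show star W * A * W * (star W * A * W) = star W * A * (W * star W) * A * W by
          noncomm_ring, hsq', mul_one, mul_assoc (star W), hA2, mul_one, hsq]
      rw [hBdef, sub_mul, mul_sub, mul_sub, hA2, h1]
      noncomm_ring
    have hcyc : (star W * A * W * A).trace = (A * star W * A * W).trace := by
      rw [trace_mul_comm]
      simp only [mul_assoc]
    rw [hexp, trace_add, trace_sub, trace_sub, hcyc, trace_one, Fintype.card_fin]
    simp only [Complex.add_re, Complex.sub_re, Complex.natCast_re]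
    ring
  have hset : {V : Matrix.unitaryGroup (Fin d) ℂ |
        δ ≤ |(star ((V : Matrix (Fin d) (Fin d) ℂ).mulVec ψ₀) ⬝ᵥ
                A.mulVec ((V : Matrix (Fin d) (Fin d) ℂ).mulVec ψ₀)).re
            - (star ((V : Matrix (Fin d) (Fin d) ℂ).mulVec ψ₀) ⬝ᵥ
                (star W * A * W).mulVec ((V : Matrix (Fin d) (Fin d) ℂ).mulVec ψ₀)).re|} =
      {V : Matrix.unitaryGroup (Fin d) ℂ | δ ^ 2 ≤
        (star ((V : Matrix (Fin d) (Fin d) ℂ) *ᵥ ψ₀) ⬝ᵥ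
          (B *ᵥ ((V : Matrix (Fin d) (Fin d) ℂ) *ᵥ ψ₀))).re ^ 2} := by
    ext V
    rw [Set.mem_ofPred_eq, Set.mem_ofPred_eq, hBdef, sub_mulVec, dotProduct_sub, Complex.sub_re,
      sq_le_sq, abs_of_pos hδ]
  have hint : Integrable (fun V : Matrix.unitaryGroup (Fin d) ℂ =>
      (star ((V : Matrix (Fin d) (Fin d) ℂ) *ᵥ ψ₀) ⬝ᵥ
        (B *ᵥ ((V : Matrix (Fin d) (Fin d) ℂ) *ᵥ ψ₀))).re ^ 2) μ :=
    integrable_comp_unitary_mulVec μ hψ₀ (g := fun φ => (star φ ⬝ᵥ (B *ᵥ φ)).re ^ 2)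
      ((Complex.continuous_re.comp (continuous_star.dotProduct
        (continuous_const.matrix_mulVec continuous_id))).pow 2)
  have hmarkov := mul_meas_ge_le_integral_of_nonneg (.of_forall fun _ => sq_nonneg _) hint (δ ^ 2)
  rw [integral_sq_re_star_dotProduct_mulVec μ hψ₀ hB, hBtr, hB2, Fintype.card_fin] at hmarkov
  rw [hset, ← ofReal_measureReal]
  refine ENNReal.ofReal_le_ofReal ?_
  rw [← mul_le_mul_iff_right₀ (pow_pos hδ 2)]
  refine hmarkov.trans_eq ?_
  rw [Complex.zero_re]
  field_simp
  ring
end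

section
/- Let d ≥ 2, let μ be the Haar probability measure on the compact group U(d) of d×d complex unitary matrices, and let S ∈ M_{d²}(ℂ) be the swap operator on ℂ^d ⊗ ℂ^d, i.e. S_{(i,j),(k,l)} = δ_{i l} δ_{j k}. Then for every X ∈ M_{d²}(ℂ), ∫_{U(d)} (V ⊗ V) X (V ⊗ V)* dμ(V) = (1/(d²−1)) · ( tr(X)·1 + tr(S X)·S − (1/d)·tr(X)·S − (1/d)·tr(S X)·1 ), where ⊗ denotes the Kronecker product and 1 the d²×d² identity matrix. -/
open Matrix MeasureTheory
open scoped Kronecker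

/-- The swap operator on `ℂ^d ⊗ ℂ^d`: `S_{(i,j),(k,l)} = δ_{il} δ_{jk}`. -/
noncomputable def swapOp (d : ℕ) : Matrix (Fin d × Fin d) (Fin d × Fin d) ℂ :=
  fun p q => if p.1 = q.2 ∧ p.2 = q.1 then 1 else 0

section CommutantOfTensorSquare

variable {d : ℕ}

lemma swapOp_mul_apply (M : Matrix (Fin d × Fin d) (Fin d × Fin d) ℂ) (p q : Fin d × Fin d) :
    (swapOp d * M) p q = M p.swap q := by
  rw [Matrix.mul_apply, Finset.sum_eq_single p.swap]
  · simp [swapOp]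
  · rintro ⟨a, b⟩ - h
    have : ¬ (p.1 = b ∧ p.2 = a) := fun h' => h (by ext <;> simp [h'.1, h'.2])
    simp [swapOp, this]
  · simp

lemma mul_swapOp_apply (M : Matrix (Fin d × Fin d) (Fin d × Fin d) ℂ) (p q : Fin d × Fin d) :
    (M * swapOp d) p q = M p q.swap := by
  rw [Matrix.mul_apply, Finset.sum_eq_single q.swap]
  · simp [swapOp]
  · rintro ⟨a, b⟩ - h
    have : ¬ (a = q.2 ∧ b = q.1) := fun h' => h (by ext <;> simp [h'.1, h'.2])
    simp [swapOp, this]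
  · simp

lemma swapOp_mul_kronecker (A : Matrix (Fin d) (Fin d) ℂ) :
    swapOp d * (A ⊗ₖ A) = (A ⊗ₖ A) * swapOp d := by
  ext p q
  simp [swapOp_mul_apply, mul_swapOp_apply, mul_comm]

lemma trace_swapOp : (swapOp d).trace = d := by
  have h : ∀ a b : Fin d, swapOp d (a, b) (a, b) = if a = b then 1 else 0 := by
    intro a b
    by_cases hab : a = b <;> simp [swapOp, hab]
  simp only [Matrix.trace, Fintype.sum_prod_type, diag_apply, h]
  simp

lemma swapOp_mul_swapOp : swapOp d * swapOp d = 1 := by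
  ext p q
  rw [swapOp_mul_apply, Matrix.one_apply]
  simp [swapOp, Prod.ext_iff, and_comm]

variable {T : Matrix (Fin d × Fin d) (Fin d × Fin d) ℂ}

/-- The diagonal matrix with the phase `I` at `a` and `1` elsewhere is unitary. -/
lemma diagonal_phase_mem_unitaryGroup (a : Fin d) :
    diagonal (fun i => if i = a then Complex.I else 1) ∈ unitaryGroup (Fin d) ℂ := by
  rw [mem_unitaryGroup_iff, star_eq_conjTranspose, diagonal_conjTranspose, diagonal_mul_diagonal,
    ← diagonal_one]
  congr 1
  ext i
  by_cases h : i = a <;> simp [h]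

lemma of_perm_mem_unitaryGroup (σ : Equiv.Perm (Fin d)) :
    (of fun i j => if σ i = j then (1 : ℂ) else 0) ∈ unitaryGroup (Fin d) ℂ := by
  rw [mem_unitaryGroup_iff]
  ext i j
  simp [Matrix.mul_apply, Matrix.one_apply, star_apply, apply_ite star, eq_comm]

lemma exists_mem_unitaryGroup_apply_ne_zero {a b : Fin d} (hab : a ≠ b) :
    ∃ U ∈ unitaryGroup (Fin d) ℂ, U a a ≠ 0 ∧ U a b ≠ 0 := by
  set P : Matrix (Fin d) (Fin d) ℂ := of fun i j => if Equiv.swap a b i = j then (1 : ℂ) else 0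
    with hP
  have hstar : star P = P := by
    ext i j
    have : Equiv.swap a b j = i ↔ Equiv.swap a b i = j := by
      rw [Equiv.swap_apply_eq_iff, eq_comm]
    simp [hP, star_apply, apply_ite star, this]
  have hPP : P * P = 1 := by
    have := mem_unitaryGroup_iff.mp (of_perm_mem_unitaryGroup (Equiv.swap a b))
    rwa [← hP, hstar] at this
  refine ⟨(3 / 5 : ℂ) • 1 + (4 / 5 * Complex.I) • P, ?_, ?_, ?_⟩
  · rw [mem_unitaryGroup_iff]
    simp only [star_add, star_smul, star_one, hstar, add_mul, mul_add, smul_mul_smul_comm, hPP,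
      one_mul, mul_one]
    have h : (3 / 5 : ℂ) * star (3 / 5) + 4 / 5 * Complex.I * star (4 / 5 * Complex.I) = 1 := by
      apply Complex.ext <;> norm_num
    have h' : (4 / 5 : ℂ) * Complex.I * star (3 / 5) + 3 / 5 * star (4 / 5 * Complex.I) = 0 := by
      apply Complex.ext <;> norm_num
    trans ((3 / 5 : ℂ) * star (3 / 5) + 4 / 5 * Complex.I * star (4 / 5 * Complex.I)) • 1
      + ((4 / 5 : ℂ) * Complex.I * star (3 / 5) + 3 / 5 * star (4 / 5 * Complex.I)) • P
    · module
    · rw [h, h', one_smul, zero_smul, add_zero]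
  · simp [hP, hab.symm]
  · simp [hP, hab]

/-- A matrix commuting with all `U ⊗ U` is invariant under relabelling of the basis. -/
lemma apply_perm_of_commute
    (hT : ∀ U ∈ unitaryGroup (Fin d) ℂ, (U ⊗ₖ U) * T = T * (U ⊗ₖ U))
    (σ : Equiv.Perm (Fin d)) (i j k l : Fin d) :
    T (σ i, σ j) (σ k, σ l) = T (i, j) (k, l) := by
  have h := congrFun₂ (hT _ (of_perm_mem_unitaryGroup σ)) (i, j) (σ k, σ l)
  simpa [Matrix.mul_apply, Fintype.sum_prod_type, ite_and, Finset.sum_ite_eq] using h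

lemma apply_eq_zero_of_commute
    (hT : ∀ U ∈ unitaryGroup (Fin d) ℂ, (U ⊗ₖ U) * T = T * (U ⊗ₖ U))
    {i j k l : Fin d} (h₁ : ¬ (i = k ∧ j = l)) (h₂ : ¬ (i = l ∧ j = k)) :
    T (i, j) (k, l) = 0 := by
  by_contra hne
  have key : ∀ a : Fin d,
      (if i = a then Complex.I else 1) * (if j = a then Complex.I else 1)
        = (if k = a then Complex.I else 1) * (if l = a then Complex.I else 1) := by
    intro a
    have h := congrFun₂ (hT _ (diagonal_phase_mem_unitaryGroup a)) (i, j) (k, l)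
    rw [diagonal_kronecker_diagonal, diagonal_mul, mul_diagonal, mul_comm] at h
    exact mul_left_cancel₀ hne h
  have hI : Complex.I ≠ 1 := fun h => by simpa using congrArg Complex.re h
  have hm : (-1 : ℂ) ≠ 1 := by norm_num
  have ki := key i
  have kj := key j
  by_cases hij : i = j <;> by_cases hik : i = k <;> by_cases hil : i = l <;>
    by_cases hjk : j = k <;> by_cases hjl : j = l <;> by_cases hkl : k = l <;>
    simp_all [eq_comm]

lemma exists_perm_apply_apply {α : Type*} [DecidableEq α] {a b i j : α} (hab : a ≠ b)
    (hij : i ≠ j) : ∃ σ : Equiv.Perm α, σ a = i ∧ σ b = j := by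
  have h : i ≠ Equiv.swap a i b := fun h =>
    hab ((Equiv.swap a i).injective ((Equiv.swap_apply_left a i).trans h))
  refine ⟨(Equiv.swap a i).trans (Equiv.swap (Equiv.swap a i b) j), ?_, ?_⟩
  · simp [Equiv.swap_apply_of_ne_of_ne h hij]
  · simp

lemma apply_diag_of_commute
    (hT : ∀ U ∈ unitaryGroup (Fin d) ℂ, (U ⊗ₖ U) * T = T * (U ⊗ₖ U))
    {a b : Fin d} (hab : a ≠ b) :
    T (a, a) (a, a) = T (a, b) (a, b) + T (a, b) (b, a) := by
  obtain ⟨U, hU, haa, hbb⟩ := exists_mem_unitaryGroup_apply_ne_zero hab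
  have h := congrFun₂ (hT U hU) (a, a) (a, b)
  have hr : (T * (U ⊗ₖ U)) (a, a) (a, b) = T (a, a) (a, a) * (U a a * U a b) := by
    rw [Matrix.mul_apply, Finset.sum_eq_single (a, a)]
    · simp
    · rintro ⟨k, l⟩ - hkl
      have hkl' : ¬ (a = k ∧ a = l) := fun h => hkl (by rw [← h.1, ← h.2])
      rw [apply_eq_zero_of_commute hT hkl' (fun h => hkl' h.symm), zero_mul]
    · simp
  have hl : ((U ⊗ₖ U) * T) (a, a) (a, b)
      = U a a * U a b * T (a, b) (a, b) + U a b * U a a * T (b, a) (a, b) := by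
    rw [Matrix.mul_apply, Finset.sum_eq_add (a, b) (b, a)]
    · simp
    · simp [hab]
    · rintro ⟨k, l⟩ - ⟨h₁, h₂⟩
      rw [apply_eq_zero_of_commute hT, mul_zero]
      · simpa using h₁
      · simpa using h₂
    · simp
    · simp
  have hsw := apply_perm_of_commute hT (Equiv.swap a b) a b b a
  simp only [Equiv.swap_apply_left, Equiv.swap_apply_right] at hsw
  rw [hl, hr, hsw] at h
  refine mul_left_cancel₀ (mul_ne_zero haa hbb) ?_
  linear_combination -h

/-- Every matrix commuting with all `U ⊗ U`, `U` unitary, is a linear combination of the identity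
and the swap operator. -/
lemma exists_eq_smul_one_add_smul_swapOp (hd : 2 ≤ d)
    (hT : ∀ U ∈ unitaryGroup (Fin d) ℂ, (U ⊗ₖ U) * T = T * (U ⊗ₖ U)) :
    ∃ α β : ℂ, T = α • 1 + β • swapOp d := by
  let a : Fin d := ⟨0, by omega⟩
  let b : Fin d := ⟨1, by omega⟩
  have hab : a ≠ b := by simp [a, b]
  refine ⟨T (a, b) (a, b), T (a, b) (b, a), ?_⟩
  have hdiag : ∀ i : Fin d, T (i, i) (i, i) = T (a, b) (a, b) + T (a, b) (b, a) := by
    intro i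
    rw [← apply_diag_of_commute hT hab]
    simpa using apply_perm_of_commute hT (Equiv.swap a i) a a a a
  ext ⟨i, j⟩ ⟨k, l⟩
  by_cases hij : i = j
  · subst hij
    by_cases h : i = k ∧ i = l
    · obtain ⟨rfl, rfl⟩ := h
      simp [swapOp, hdiag]
    · rw [apply_eq_zero_of_commute hT h (fun h' => h h'.symm)]
      have h' : ¬ (i = l ∧ i = k) := fun h' => h h'.symm
      simp [swapOp, h, h']
  · obtain ⟨σ, rfl, rfl⟩ := exists_perm_apply_apply hab hij
    by_cases h₁ : σ a = k ∧ σ b = l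
    · obtain ⟨rfl, rfl⟩ := h₁
      simp [swapOp, hij, apply_perm_of_commute hT]
    · by_cases h₂ : σ a = l ∧ σ b = k
      · obtain ⟨rfl, rfl⟩ := h₂
        simp [swapOp, hij, apply_perm_of_commute hT]
      · rw [apply_eq_zero_of_commute hT h₁ h₂]
        simp [swapOp, h₁, h₂]

end CommutantOfTensorSquare

section Twirl

variable {d : ℕ}

/-- The conjugate of `X` by `V ⊗ V`. -/
noncomputable def kroneckerConj (X : Matrix (Fin d × Fin d) (Fin d × Fin d) ℂ)
    (V : Matrix (Fin d) (Fin d) ℂ) : Matrix (Fin d × Fin d) (Fin d × Fin d) ℂ :=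
  (V ⊗ₖ V) * X * star (V ⊗ₖ V)

variable (X : Matrix (Fin d × Fin d) (Fin d × Fin d) ℂ)

lemma star_kronecker_mul_self {U : Matrix (Fin d) (Fin d) ℂ} (hU : U ∈ unitaryGroup (Fin d) ℂ) :
    star (U ⊗ₖ U) * (U ⊗ₖ U) = 1 := by
  rw [star_eq_conjTranspose, conjTranspose_kronecker, ← mul_kronecker_mul,
    ← star_eq_conjTranspose, mem_unitaryGroup_iff'.mp hU, one_kronecker_one]

lemma kroneckerConj_mul (U V : Matrix (Fin d) (Fin d) ℂ) :
    kroneckerConj X (U * V) = kroneckerConj (kroneckerConj X V) U := by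
  simp only [kroneckerConj, mul_kronecker_mul, star_mul, Matrix.mul_assoc]

lemma trace_kroneckerConj {V : Matrix (Fin d) (Fin d) ℂ} (hV : V ∈ unitaryGroup (Fin d) ℂ) :
    (kroneckerConj X V).trace = X.trace := by
  rw [kroneckerConj, trace_mul_comm, ← Matrix.mul_assoc, star_kronecker_mul_self hV,
    Matrix.one_mul]

lemma swapOp_mul_kroneckerConj (V : Matrix (Fin d) (Fin d) ℂ) :
    swapOp d * kroneckerConj X V = kroneckerConj (swapOp d * X) V := by
  simp only [kroneckerConj, ← Matrix.mul_assoc, swapOp_mul_kronecker]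

lemma continuous_kroneckerConj_apply (p q : Fin d × Fin d) :
    Continuous fun V : unitaryGroup (Fin d) ℂ => kroneckerConj X V p q := by
  have hV : ∀ i j, Continuous fun V : unitaryGroup (Fin d) ℂ =>
      (V : Matrix (Fin d) (Fin d) ℂ) i j := fun i j => continuous_subtype_val.matrix_elem i j
  simp only [kroneckerConj, Matrix.mul_apply, star_apply, kroneckerMap_apply]
  exact continuous_finsetSum _ fun s _ => (continuous_finsetSum _ fun r _ =>
    ((hV _ _).mul (hV _ _)).mul continuous_const).mul ((hV _ _).mul (hV _ _)).star

variable [MeasurableSpace (unitaryGroup (Fin d) ℂ)]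

/-- The two-fold twirl of `X`: the entrywise average of `(V ⊗ V) X (V ⊗ V)*`. -/
noncomputable def twirl (μ : Measure (unitaryGroup (Fin d) ℂ))
    (X : Matrix (Fin d × Fin d) (Fin d × Fin d) ℂ) :
    Matrix (Fin d × Fin d) (Fin d × Fin d) ℂ :=
  of fun p q => ∫ V : unitaryGroup (Fin d) ℂ, kroneckerConj X V p q ∂μ

variable [BorelSpace (unitaryGroup (Fin d) ℂ)] (μ : Measure (unitaryGroup (Fin d) ℂ))
  [IsProbabilityMeasure μ]

lemma integrable_kroneckerConj_apply (p q : Fin d × Fin d) :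
    Integrable (fun V : unitaryGroup (Fin d) ℂ => kroneckerConj X V p q) μ := by
  refine Integrable.of_bound (continuous_kroneckerConj_apply X p q).aestronglyMeasurable
    (∑ s, ∑ r, ‖X r s‖) (ae_of_all _ fun V => ?_)
  have hK : ∀ r s, ‖((V : Matrix (Fin d) (Fin d) ℂ) ⊗ₖ (V : Matrix (Fin d) (Fin d) ℂ)) r s‖ ≤ 1 :=
    fun r s => by
      rw [kronecker_apply, norm_mul]
      exact mul_le_one₀ (entry_norm_bound_of_unitary V.2 _ _) (norm_nonneg _)
        (entry_norm_bound_of_unitary V.2 _ _)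
  rw [kroneckerConj, Matrix.mul_apply]
  refine (norm_sum_le _ _).trans (Finset.sum_le_sum fun s _ => ?_)
  rw [norm_mul, star_apply, norm_star]
  refine (mul_le_of_le_one_right (norm_nonneg _) (hK q s)).trans ?_
  rw [Matrix.mul_apply]
  refine (norm_sum_le _ _).trans (Finset.sum_le_sum fun r _ => ?_)
  rw [norm_mul]
  exact mul_le_of_le_one_left (norm_nonneg _) (hK p r)

lemma map_twirl (L : Matrix (Fin d × Fin d) (Fin d × Fin d) ℂ →ₗ[ℂ] ℂ) :
    L (twirl μ X) = ∫ V : unitaryGroup (Fin d) ℂ, L (kroneckerConj X V) ∂μ := by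
  have hL : ∀ M, L M = ∑ p, ∑ q, M p q * L (single p q 1) := by
    intro M
    conv_lhs => rw [matrix_eq_sum_single M]
    simp only [map_sum]
    refine Finset.sum_congr rfl fun p _ => Finset.sum_congr rfl fun q _ => ?_
    rw [← smul_eq_mul, ← map_smul, smul_single, smul_eq_mul, mul_one]
  simp only [hL (kroneckerConj X _), hL (twirl μ X)]
  have hint := fun p q => (integrable_kroneckerConj_apply X μ p q).mul_const (L (single p q 1))
  rw [integral_finsetSum _ fun p _ => integrable_finsetSum _ fun q _ => hint p q]
  refine Finset.sum_congr rfl fun p _ => ?_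
  rw [integral_finsetSum _ fun q _ => hint p q]
  refine Finset.sum_congr rfl fun q _ => ?_
  rw [integral_mul_const]
  rfl

lemma trace_twirl : (twirl μ X).trace = X.trace := by
  have h := map_twirl X μ (traceLinearMap _ ℂ ℂ)
  simpa [trace_kroneckerConj X (Subtype.prop _)] using h

lemma trace_swapOp_mul_twirl : (swapOp d * twirl μ X).trace = (swapOp d * X).trace := by
  have h := map_twirl X μ (traceLinearMap _ ℂ ℂ ∘ₗ LinearMap.mulLeft ℂ (swapOp d))
  simpa [swapOp_mul_kroneckerConj, trace_kroneckerConj _ (Subtype.prop _)] using h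

lemma kronecker_mul_twirl [μ.IsHaarMeasure] {U : Matrix (Fin d) (Fin d) ℂ}
    (hU : U ∈ unitaryGroup (Fin d) ℂ) :
    (U ⊗ₖ U) * twirl μ X = twirl μ X * (U ⊗ₖ U) := by
  have hconj : kroneckerConj (twirl μ X) U = twirl μ X := by
    ext p q
    have h := map_twirl X μ (entryLinearMap ℂ ℂ p q ∘ₗ
      LinearMap.mulRight ℂ (star (U ⊗ₖ U)) ∘ₗ LinearMap.mulLeft ℂ (U ⊗ₖ U))
    simp only [LinearMap.comp_apply, LinearMap.mulLeft_apply, LinearMap.mulRight_apply,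
      entryLinearMap_apply] at h
    rw [kroneckerConj, h]
    refine Eq.trans ?_ (integral_mul_left_eq_self
      (fun V : unitaryGroup (Fin d) ℂ => kroneckerConj X V p q) ⟨U, hU⟩)
    refine integral_congr_ae (ae_of_all _ fun V => ?_)
    exact (congrFun₂ (kroneckerConj_mul X U V) p q).symm
  conv_rhs => rw [← hconj]
  rw [kroneckerConj, Matrix.mul_assoc _ (star _), star_kronecker_mul_self hU, Matrix.mul_one]

end Twirl

/-- The two-fold twirl (Weingarten) formula for the unitary group:
`∫ (V⊗V) X (V⊗V)* dμ = (tr(X)·1 + tr(SX)·S - tr(X)·S/d - tr(SX)·1/d)/(d²-1)`,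
entrywise, where `S` is the swap operator. -/
theorem stmt7 {d : ℕ} (hd : 2 ≤ d)
    [MeasurableSpace (Matrix.unitaryGroup (Fin d) ℂ)]
    [BorelSpace (Matrix.unitaryGroup (Fin d) ℂ)]
    (μ : Measure (Matrix.unitaryGroup (Fin d) ℂ))
    [μ.IsHaarMeasure] [IsProbabilityMeasure μ]
    (X : Matrix (Fin d × Fin d) (Fin d × Fin d) ℂ) (p q : Fin d × Fin d) :
    ∫ V : Matrix.unitaryGroup (Fin d) ℂ,
        (((V : Matrix (Fin d) (Fin d) ℂ) ⊗ₖ (V : Matrix (Fin d) (Fin d) ℂ)) * X *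
          star ((V : Matrix (Fin d) (Fin d) ℂ) ⊗ₖ (V : Matrix (Fin d) (Fin d) ℂ))) p q ∂μ
      = ((1 / ((d : ℂ) ^ 2 - 1)) •
          (X.trace • (1 : Matrix (Fin d × Fin d) (Fin d × Fin d) ℂ)
            + (swapOp d * X).trace • swapOp d
            - ((1 / (d : ℂ)) * X.trace) • swapOp d
            - ((1 / (d : ℂ)) * (swapOp d * X).trace) •
                (1 : Matrix (Fin d × Fin d) (Fin d × Fin d) ℂ))) p q := by
  change twirl μ X p q = _
  obtain ⟨α, β, hT⟩ := exists_eq_smul_one_add_smul_swapOp hd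
    fun U hU => kronecker_mul_twirl X μ hU
  have h₁ := trace_twirl X μ
  have h₂ := trace_swapOp_mul_twirl X μ
  rw [hT] at h₁ h₂ ⊢
  simp only [mul_add, Matrix.mul_smul, Matrix.mul_one, swapOp_mul_swapOp, trace_add, trace_smul,
    trace_one, trace_swapOp, Fintype.card_prod, Fintype.card_fin, smul_eq_mul, Nat.cast_mul]
    at h₁ h₂
  have hd0 : (d : ℂ) ≠ 0 := by
    have : d ≠ 0 := by omega
    exact_mod_cast this
  have hd1 : (d : ℂ) ^ 2 - 1 ≠ 0 := by
    have : d ^ 2 ≠ 1 := by nlinarith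
    rw [sub_ne_zero]
    exact_mod_cast this
  rw [← h₁, ← h₂]
  simp only [Matrix.add_apply, Matrix.sub_apply, Matrix.smul_apply, smul_eq_mul]
  field_simp
  ring
end
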